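/- (Character sum bound, m = 1.) Let m = 1, so B = F_p is the prime field and Tr : F → F_p is the absolute trace, with |F| = p^t. For every polynomial f over F of degree at most k−1, if the word (Tr(f(α)/α))_{α∈F∖{0}} is not identically zero, then its number w of nonzero coordinates satisfies, as real numbers, w ≥ ((p−1)/p)·(p^t − 1 − (k−1)·√(p^t)). -/

import Mathlib

open Polynomial

theorem exists_ne_zero_sum_smul_eq_zero_of_degree_lt {K ι : Type*} [Field K] [Fintype ι]
    (w : ι → K[X]) (T : ℕ) (hw : ∀ i, (w i).degree < T) (hT : T < Fintype.card ι) :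
    ∃ γ : ι → K, γ ≠ 0 ∧ ∑ i, C (γ i) * w i = 0 := by
  let v : ι → degreeLT K T := fun i => ⟨w i, mem_degreeLT.2 (hw i)⟩
  have hv : ¬ LinearIndependent K v := fun h => by
    have h1 := h.fintype_card_le_finrank
    rw [LinearEquiv.finrank_eq (degreeLTEquiv K T), Module.finrank_fin_fun] at h1
    omega
  obtain ⟨γ, h0, i, hi⟩ := Fintype.not_linearIndependent_iff.1 hv
  refine ⟨γ, fun h => hi (by simp [h]), ?_⟩
  have := congrArg (Subtype.val) h0
  simpa [v, smul_eq_C_mul] using this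

theorem sum_C_mul_ne_zero_of_natDegree_injective {K ι : Type*} [Field K] [Fintype ι]
    (w : ι → K[X]) (hw0 : ∀ i, w i ≠ 0) (hw : Function.Injective fun i => (w i).natDegree)
    (γ : ι → K) (hγ : γ ≠ 0) : ∑ i, C (γ i) * w i ≠ 0 := by
  obtain ⟨i, hi⟩ := Function.ne_iff.1 hγ
  have hi : γ i ≠ 0 := hi
  intro h
  have h1 := degree_sum_eq_of_disjoint (fun i => C (γ i) * w i) Finset.univ (by
    rintro a ⟨-, ha⟩ b ⟨-, hb⟩ hab hd
    have ha' : γ a ≠ 0 := fun h => ha (by simp [h])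
    have hb' : γ b ≠ 0 := fun h => hb (by simp [h])
    refine hab (hw ?_)
    simp only [Function.comp_apply] at hd
    have := natDegree_eq_of_degree_eq hd
    rwa [natDegree_C_mul ha', natDegree_C_mul hb'] at this)
  rw [h, degree_zero] at h1
  have h2 := Finset.le_sup (f := fun i => degree (C (γ i) * w i)) (Finset.mem_univ i)
  rw [← h1, le_bot_iff, degree_eq_bot, mul_eq_zero, C_eq_zero] at h2
  exact h2.elim hi (hw0 i)

/-- The partial trace `∑_{r ≤ i} (g / X ^ E) ^ (p ^ r)`, cleared of denominators. -/
noncomputable def partialTrace {K : Type*} [Field K] (p : ℕ) (g : K[X]) (E i : ℕ) : K[X] :=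
  ∑ r ∈ Finset.range (i + 1), X ^ (E * (p ^ i - p ^ r)) * g ^ p ^ r

theorem eval_partialTrace {K : Type*} [Field K] {p : ℕ} (hp : p.Prime) (g : K[X]) (E i : ℕ)
    {x : K} (hx : x ≠ 0) :
    (partialTrace p g E i).eval x =
      x ^ (E * p ^ i) * ∑ r ∈ Finset.range (i + 1), (g.eval x / x ^ E) ^ p ^ r := by
  rw [partialTrace, eval_finsetSum, Finset.mul_sum]
  refine Finset.sum_congr rfl fun r hr => ?_
  have hle : p ^ r ≤ p ^ i := Nat.pow_le_pow_right hp.pos (by simpa [Nat.lt_succ_iff] using hr)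
  rw [eval_mul, eval_pow, eval_pow, eval_X, div_pow, ← pow_mul]
  have : x ^ (E * p ^ i) = x ^ (E * (p ^ i - p ^ r)) * x ^ (E * p ^ r) := by
    rw [← pow_add, ← mul_add, Nat.sub_add_cancel hle]
  rw [this]
  field_simp

theorem degree_partialTrace {K : Type*} [Field K] {p : ℕ} (hp : p.Prime) {g : K[X]} {D E : ℕ}
    (hg : g.natDegree = D + E) (hD : D ≠ 0) (i : ℕ) :
    (partialTrace p g E i).degree = ((D + E) * p ^ i : ℕ) := by
  have hg0 : g ≠ 0 := by rintro rfl; simp at hg; omega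
  rw [partialTrace, Finset.sum_range_succ]
  have htop : (X ^ (E * (p ^ i - p ^ i)) * g ^ p ^ i : K[X]).degree = ((D + E) * p ^ i : ℕ) := by
    rw [degree_eq_natDegree (by simp [hg0])]
    simp [hg, mul_comm]
  rw [degree_add_eq_right_of_degree_lt, htop]
  rw [htop]
  refine (degree_sum_le _ _).trans_lt ((Finset.sup_lt_iff (WithBot.bot_lt_coe _)).2 fun r hr => ?_)
  have hlt : p ^ r < p ^ i := Nat.pow_lt_pow_right hp.one_lt (by simpa using hr)
  rw [degree_eq_natDegree (by simp [hg0]), natDegree_X_pow_mul _ (by simp [hg0]), natDegree_pow, hg]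
  norm_cast
  obtain ⟨d, hd⟩ := Nat.exists_eq_add_of_lt hlt
  rw [hd, show p ^ r + d + 1 - p ^ r = d + 1 by omega]
  have : 0 < D := Nat.pos_of_ne_zero hD
  nlinarith

theorem stepanov_bound_of_split {K : Type*} [Field K] [IsAlgClosed K] {p : ℕ} [hp : Fact p.Prime]
    [CharP K p] {g : K[X]} {D E : ℕ} (hg : g.natDegree = D + E) (hD : ¬ p ∣ D) {i j : ℕ}
    (hij : j ≤ i + 1) (c : K) (A : Finset K)
    (hA : ∀ x ∈ A, x ≠ 0 ∧ x ^ p ^ (i + 1 + (j + 1)) = x ∧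
      ∑ r ∈ Finset.range (i + 1 + (j + 1)), (g.eval x / x ^ E) ^ p ^ r = c) :
    A.card ≤ p ^ (i + j + 1) + (2 + 2 * (D + E) * p + (D + E)) * p ^ (i + 1) := by
  classical
  have hp1 := hp.out
  have hD0 : D ≠ 0 := by rintro rfl; simp at hD
  set U := partialTrace p g E i with hU
  set V := partialTrace p g E j with hV
  have hUd : U.degree = ((D + E) * p ^ i : ℕ) := degree_partialTrace hp1 hg hD0 i
  have hVd : V.degree = ((D + E) * p ^ j : ℕ) := degree_partialTrace hp1 hg hD0 j
  have hU0 : U ≠ 0 := by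
    rw [← degree_ne_bot, hUd]
    exact WithBot.coe_ne_bot
  have hUn : U.natDegree = (D + E) * p ^ i := natDegree_eq_of_degree_eq_some hUd
  have hVn : V.natDegree = (D + E) * p ^ j := natDegree_eq_of_degree_eq_some hVd
  set m := p ^ j + (2 * (D + E) * p + 1) with hm
  let ι := Fin (p ^ i) × Fin m × Fin p
  let w : ι → K[X] := fun a => X ^ ((a.1 : ℕ) * p ^ (j + 1) + a.2.1) *
    (X ^ (E * p ^ j * (p - 1 - a.2.2)) * (C c * X ^ (E * p ^ j) - V) ^ (a.2.2 : ℕ))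
  let z : ι → K[X] := fun a => X ^ ((a.1 : ℕ) + a.2.1 * p ^ (i + 1)) *
    (X ^ (E * p ^ i * (p - 1 - a.2.2)) * U ^ (a.2.2 : ℕ))
  have hzd : ∀ a : ι, (z a).natDegree =
      E * p ^ i * (p - 1) + (a.1 + p ^ i * (p * a.2.1 + D * a.2.2)) := by
    rintro ⟨a, b, k⟩
    obtain ⟨d, hd⟩ : ∃ d, p - 1 = k + d := ⟨p - 1 - k, by omega⟩
    simp only [z]
    rw [natDegree_X_pow_mul _ (by simp [hU0]), natDegree_X_pow_mul _ (by simp [hU0]),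
      natDegree_pow, hUn, hd, Nat.add_sub_cancel_left]
    ring
  have hz0 : ∀ a : ι, z a ≠ 0 := fun a => by simp [z, hU0]
  have hzinj : Function.Injective fun a => (z a).natDegree := by
    rintro ⟨a, b, k⟩ ⟨a', b', k'⟩ h
    simp only [hzd] at h
    have h := Nat.add_left_cancel h
    have hpi : 0 < p ^ i := pow_pos hp1.pos _
    have h1 : (a : ℕ) = a' := by
      have := congrArg (· % p ^ i) h
      simpa [Nat.add_mul_mod_self_left, Nat.mod_eq_of_lt a.2, Nat.mod_eq_of_lt a'.2] using this
    rw [h1] at h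
    have h := Nat.eq_of_mul_eq_mul_left hpi (Nat.add_left_cancel h)
    have h2 : (k : ℕ) = k' := by
      have h3 : D * k ≡ D * k' [MOD p] := by
        have := congrArg (· % p) h
        simpa [Nat.ModEq, Nat.mul_add_mod] using this
      have h4 := Nat.ModEq.cancel_left_of_coprime
        ((Nat.Prime.coprime_iff_not_dvd hp1).2 hD) h3
      exact Nat.ModEq.eq_of_lt_of_lt h4 k.2 k'.2
    rw [h2] at h
    have h5 := Nat.eq_of_mul_eq_mul_left hp1.pos (Nat.add_right_cancel h)
    exact Prod.ext (Fin.ext h1) (Prod.ext (Fin.ext h5) (Fin.ext h2))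
  have hpi : 1 ≤ p ^ i := pow_pos hp1.pos _
  have hpj : 1 ≤ p ^ j := pow_pos hp1.pos _
  have hp2 := hp1.two_le
  have hwd : ∀ a : ι, (w a).degree <
      (((p ^ i - 1) * p ^ (j + 1) + m + (D + E) * p ^ j * (p - 1) : ℕ) : WithBot ℕ) := by
    rintro ⟨a, b, k⟩
    have hb : (b : ℕ) + 1 ≤ m := b.2
    refine lt_of_le_of_lt (b := (((p ^ i - 1) * p ^ (j + 1) + b +
      (D + E) * p ^ j * (p - 1) : ℕ) : WithBot ℕ)) ?_ (by norm_cast; omega)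
    refine degree_le_of_natDegree_le ?_
    have h1 : (C c * X ^ (E * p ^ j) - V).natDegree ≤ (D + E) * p ^ j := by
      refine (natDegree_sub_le _ _).trans (max_le ((natDegree_C_mul_X_pow_le _ _).trans ?_) hVn.le)
      gcongr; omega
    refine natDegree_mul_le.trans (add_le_add ?_ (natDegree_mul_le.trans ?_))
    · rw [natDegree_X_pow]; gcongr; omega
    · rw [natDegree_X_pow]
      obtain ⟨d, hd⟩ : ∃ d, p - 1 = k + d := ⟨p - 1 - k, by omega⟩
      have h2 := (natDegree_pow_le_of_le (k : ℕ) h1)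
      simp only
      rw [hd, Nat.add_sub_cancel_left]
      calc _ ≤ E * p ^ j * d + k * ((D + E) * p ^ j) := by gcongr
        _ ≤ (D + E) * p ^ j * d + k * ((D + E) * p ^ j) := by gcongr; omega
        _ = _ := by ring
  have hcard : (p ^ i - 1) * p ^ (j + 1) + m + (D + E) * p ^ j * (p - 1) < Fintype.card ι := by
    simp only [ι, Fintype.card_prod, Fintype.card_fin]
    have h1 : p ^ j ≤ p ^ (i + 1) := Nat.pow_le_pow_right hp1.pos hij
    have h2 : (p ^ i - 1) * p ^ (j + 1) + p ^ (j + 1) = p ^ i * p ^ (j + 1) := by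
      rw [← Nat.succ_mul]; congr 1; omega
    have h3 : (D + E) * p ^ j * (p - 1) ≤ (D + E) * p ^ (i + 1) * p := by gcongr; omega
    have h4 : p ^ j ≤ p ^ (j + 1) := Nat.pow_le_pow_right hp1.pos (by omega)
    have h5 : 2 ≤ p ^ (i + 1) := by rw [pow_succ]; nlinarith
    have h6 : p ^ i * (m * p) = p ^ i * p ^ (j + 1) + (2 * (D + E) * p + 1) * p ^ (i + 1) := by
      rw [hm]; ring
    have h7 : (D + E) * p ^ (i + 1) * p = (D + E) * p * p ^ (i + 1) := by ring
    have h8 : (D + E) * p * 2 ≤ (D + E) * p * p ^ (i + 1) := Nat.mul_le_mul_left _ h5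
    rw [h6, hm]
    nlinarith
  obtain ⟨δ, hδ0, hδ⟩ := exists_ne_zero_sum_smul_eq_zero_of_degree_lt w _ hwd hcard
  have hpj1 : 0 < p ^ (j + 1) := pow_pos hp1.pos _
  choose γ hγ using fun a => IsAlgClosed.exists_pow_nat_eq (δ a) hpj1
  have hγ0 : γ ≠ 0 := by
    rintro rfl
    exact hδ0 (funext fun a => by rw [← hγ]; simp [hp1.ne_zero])
  have hZ := sum_C_mul_ne_zero_of_natDegree_injective z hz0 hzinj γ hγ0
  set Z := ∑ a, C (γ a) * z a with hZdef
  have hroot : ∀ x ∈ A, Z.IsRoot x := by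
    intro x hxA
    obtain ⟨hx0, hxq, hxt⟩ := hA x hxA
    set u := ∑ r ∈ Finset.range (i + 1), (g.eval x / x ^ E) ^ p ^ r with hu
    set v := ∑ r ∈ Finset.range (j + 1), (g.eval x / x ^ E) ^ p ^ r with hv
    have hUx : U.eval x = x ^ (E * p ^ i) * u := eval_partialTrace hp1 g E i hx0
    have hVx : V.eval x = x ^ (E * p ^ j) * v := eval_partialTrace hp1 g E j hx0
    have huv : u ^ p ^ (j + 1) = c - v := by
      rw [eq_sub_iff_add_eq, ← hxt, add_comm (i + 1), Finset.sum_range_add, add_comm, hu, hv,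
        sum_pow_char_pow]
      simp only [← pow_mul, ← pow_add, add_comm]
    have hZx : Z.eval x = x ^ (E * p ^ i * (p - 1)) *
        ∑ a : ι, γ a * (x ^ ((a.1 : ℕ) + a.2.1 * p ^ (i + 1)) * u ^ (a.2.2 : ℕ)) := by
      rw [hZdef, eval_finsetSum, Finset.mul_sum]
      refine Finset.sum_congr rfl fun a _ => ?_
      obtain ⟨d, hd⟩ : ∃ d, p - 1 = a.2.2 + d := ⟨p - 1 - a.2.2, by omega⟩
      simp only [z, eval_mul, eval_C, eval_pow, eval_X, hUx, hd, Nat.add_sub_cancel_left]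
      ring
    have hWx : 0 = x ^ (E * p ^ j * (p - 1)) *
        ∑ a : ι, δ a * (x ^ ((a.1 : ℕ) * p ^ (j + 1) + a.2.1) * (c - v) ^ (a.2.2 : ℕ)) := by
      have := congrArg (eval x) hδ
      rw [eval_zero, eval_finsetSum] at this
      rw [← this, Finset.mul_sum]
      refine Finset.sum_congr rfl fun a _ => ?_
      obtain ⟨d, hd⟩ : ∃ d, p - 1 = a.2.2 + d := ⟨p - 1 - a.2.2, by omega⟩
      simp only [w, eval_mul, eval_C, eval_pow, eval_X, eval_sub, hVx, hd, Nat.add_sub_cancel_left]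
      rw [show c * x ^ (E * p ^ j) - x ^ (E * p ^ j) * v = x ^ (E * p ^ j) * (c - v) by ring,
        mul_pow]
      ring
    rw [zero_eq_mul, or_iff_right (pow_ne_zero _ hx0)] at hWx
    rw [IsRoot, hZx, mul_eq_zero, or_iff_right (pow_ne_zero _ hx0)]
    refine (pow_eq_zero_iff hpj1.ne').1 ?_
    rw [sum_pow_char_pow, ← hWx]
    refine Finset.sum_congr rfl fun a _ => ?_
    have hxb : (x ^ ((a.2.1 : ℕ) * p ^ (i + 1))) ^ p ^ (j + 1) = x ^ (a.2.1 : ℕ) := by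
      rw [← pow_mul, mul_assoc, ← pow_add, mul_comm, pow_mul, hxq]
    rw [mul_pow, mul_pow, hγ, ← huv, pow_right_comm u, pow_add, mul_pow, hxb, ← pow_mul x, ← pow_add]
  have hsub : A ⊆ Z.roots.toFinset := fun x hx => by
    simpa [hZ] using hroot x hx
  have hZd : Z.natDegree ≤ p ^ i + p ^ (i + 1) * m + (D + E) * p ^ (i + 1) := by
    refine natDegree_sum_le_of_forall_le _ _ fun a _ => ?_
    refine (natDegree_C_mul_le _ _).trans ?_
    rw [hzd]
    have ha := a.1.2.le
    have hb := a.2.1.2.le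
    have hk : (a.2.2 : ℕ) ≤ p - 1 := by omega
    calc _ ≤ E * p ^ i * (p - 1) + (p ^ i + p ^ i * (p * m + D * (p - 1))) := by gcongr
      _ = p ^ i + p ^ (i + 1) * m + (D + E) * (p ^ i * (p - 1)) := by ring
      _ ≤ _ := by rw [pow_succ]; gcongr; omega
  calc A.card ≤ Z.roots.toFinset.card := Finset.card_le_card hsub
    _ ≤ Multiset.card Z.roots := Multiset.toFinset_card_le _
    _ ≤ Z.natDegree := card_roots' _
    _ ≤ _ := hZd
    _ ≤ p ^ (i + 1) + p ^ (i + 1) * m + (D + E) * p ^ (i + 1) := by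
      gcongr
      · exact hp1.pos
      · omega
    _ = _ := by rw [hm]; ring

theorem stepanov_bound {K : Type*} [Field K] [IsAlgClosed K] {p : ℕ} [hp : Fact p.Prime]
    [CharP K p] {g : K[X]} {D E : ℕ} (hg : g.natDegree = D + E) (hD : ¬ p ∣ D) {s : ℕ}
    (hs : 1 ≤ s) (c : K) (A : Finset K)
    (hA : ∀ x ∈ A, x ≠ 0 ∧ x ^ p ^ s = x ∧
      ∑ r ∈ Finset.range s, (g.eval x / x ^ E) ^ p ^ r = c) :
    A.card ≤ p ^ (s - 1) + (2 + 2 * (D + E) * p + (D + E)) * p ^ (s / 2) := by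
  classical
  obtain rfl | hs2 : s = 1 ∨ 2 ≤ s := by omega
  · have hp1 := hp.out
    have hD0 : D ≠ 0 := by rintro rfl; simp at hD
    have hsub : A ⊆ (X ^ p - X : K[X]).roots.toFinset := fun x hx => by
      have := (hA x hx).2.1
      simp only [Multiset.mem_toFinset, mem_roots (FiniteField.X_pow_card_sub_X_ne_zero K hp1.one_lt)]
      simp [IsRoot, sub_eq_zero] at this ⊢
      exact this
    have h1 : A.card ≤ p := calc
      A.card ≤ _ := Finset.card_le_card hsub
      _ ≤ _ := Multiset.toFinset_card_le _
      _ ≤ _ := card_roots' _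
      _ = p := FiniteField.X_pow_card_sub_X_natDegree_eq K hp1.one_lt
    have h2 : 1 * p ≤ (D + E) * p := Nat.mul_le_mul_right _ (by omega)
    simp only [Nat.sub_self, pow_zero, Nat.reduceDiv, mul_one]
    nlinarith
  · obtain ⟨i, j, h1, h2, h3⟩ : ∃ i j, s = i + 1 + (j + 1) ∧ j ≤ i + 1 ∧ s / 2 = i + 1 :=
      ⟨s / 2 - 1, s - s / 2 - 1, by omega, by omega, by omega⟩
    rw [h3, show s - 1 = i + j + 1 by omega]
    exact stepanov_bound_of_split hg hD h2 c A (h1 ▸ hA)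

theorem norm_eval_derivative_le_of_newton_recursion {L : ℂ[X]} {S : ℕ → ℂ} {R B : ℝ} (hR : 0 < R)
    (hrec : ∀ d : ℕ, ((d : ℂ) + 1) * L.coeff (d + 1) =
      ∑ x ∈ Finset.HasAntidiagonal.antidiagonal d, S (x.1 + 1) * L.coeff x.2)
    (hS : ∀ n, ‖S (n + 1)‖ ≤ B * R ^ (n + 1)) {z : ℂ} (hz : R * ‖z‖ < 1) :
    ‖L.derivative.eval z‖ ≤ B * R / (1 - R * ‖z‖) * ‖L.eval z‖ := by
  have heval : ∀ P : ℂ[X], HasSum (fun i => P.coeff i * z ^ i) (P.eval z) := fun P => by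
    rw [eval_eq_sum_range]
    refine hasSum_sum_of_ne_finset_zero fun i hi => ?_
    rw [coeff_eq_zero_of_natDegree_lt (by simpa using hi), zero_mul]
  have hgeo : HasSum (fun n => B * R * (R * ‖z‖) ^ n) (B * R * (1 - R * ‖z‖)⁻¹) :=
    (hasSum_geometric_of_lt_one (by positivity) hz).mul_left _
  have hb : ∀ n, ‖S (n + 1) * z ^ n‖ ≤ B * R * (R * ‖z‖) ^ n := fun n => by
    rw [norm_mul, norm_pow]
    calc _ ≤ B * R ^ (n + 1) * ‖z‖ ^ n := by gcongr; exact hS n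
      _ = _ := by ring
  have hsn : Summable fun n => ‖S (n + 1) * z ^ n‖ :=
    Summable.of_nonneg_of_le (fun _ => norm_nonneg _) hb hgeo.summable
  have hLn : Summable fun n => ‖L.coeff n * z ^ n‖ := by
    refine summable_of_ne_finset_zero (s := Finset.range (L.natDegree + 1)) fun i hi => ?_
    rw [coeff_eq_zero_of_natDegree_lt (by simpa using hi), zero_mul, norm_zero]
  have hprod := tsum_mul_tsum_eq_tsum_sum_antidiagonal_of_summable_norm hsn hLn
  have hL' : L.derivative.eval z = (∑' n, S (n + 1) * z ^ n) * L.eval z := by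
    rw [← (heval L).tsum_eq, hprod, ← (heval L.derivative).tsum_eq]
    refine tsum_congr fun d => ?_
    rw [coeff_derivative, mul_comm (L.coeff _), hrec, Finset.sum_mul]
    refine Finset.sum_congr rfl fun x hx => ?_
    rw [← Finset.HasAntidiagonal.mem_antidiagonal.1 hx, pow_add]
    ring
  rw [hL', norm_mul, div_eq_mul_inv]
  gcongr
  exact tsum_of_norm_bounded hgeo hb

theorem eval_ne_zero_of_newton_recursion {L : ℂ[X]} (hL : L ≠ 0) {S : ℕ → ℂ} {R B : ℝ} (hR : 0 < R)
    (hrec : ∀ d : ℕ, ((d : ℂ) + 1) * L.coeff (d + 1) =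
      ∑ x ∈ Finset.HasAntidiagonal.antidiagonal d, S (x.1 + 1) * L.coeff x.2)
    (hS : ∀ n, ‖S (n + 1)‖ ≤ B * R ^ (n + 1)) {z : ℂ} (hz : R * ‖z‖ < 1) :
    L.eval z ≠ 0 := by
  intro h0
  have hroot : L.IsRoot z := h0
  have hL' : L.derivative ≠ 0 := fun h => by
    have := derivative_eq_zero.1 h
    rw [eq_C_of_natDegree_eq_zero this, eval_C] at h0
    rw [eq_C_of_natDegree_eq_zero this, h0, C_0] at hL
    exact hL rfl
  have hm := (rootMultiplicity_pos hL).2 hroot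
  obtain ⟨P, hP, -⟩ := exists_eq_pow_rootMultiplicity_mul_and_not_dvd L hL z
  obtain ⟨Q, hQ, hQz⟩ := exists_eq_pow_rootMultiplicity_mul_and_not_dvd L.derivative hL' z
  rw [derivative_rootMultiplicity_of_root hroot] at hQ
  obtain ⟨m, hm⟩ : ∃ m, L.rootMultiplicity z = m + 1 := ⟨_, (Nat.sub_add_cancel hm).symm⟩
  rw [hm] at hP hQ
  rw [dvd_iff_isRoot] at hQz
  refine hQz ?_
  have hcont : ContinuousAt (fun w : ℂ => B * R / (1 - R * ‖w‖) * (‖w - z‖ * ‖P.eval w‖)) z := by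
    have : (1 - R * ‖z‖) ≠ 0 := by linarith
    fun_prop (disch := exact this)
  have h1 : Filter.Tendsto (fun w : ℂ => ‖Q.eval w‖) (nhdsWithin z {z}ᶜ) (nhds ‖Q.eval z‖) :=
    (Q.continuous.norm.tendsto z).mono_left nhdsWithin_le_nhds
  have h2 := hcont.tendsto.mono_left (nhdsWithin_le_nhds (s := {z}ᶜ))
  have h3 : ‖Q.eval z‖ ≤ B * R / (1 - R * ‖z‖) * (‖z - z‖ * ‖P.eval z‖) := by
    refine le_of_tendsto_of_tendsto h1 h2 ?_
    have hev : ∀ᶠ w in nhdsWithin z {z}ᶜ, R * ‖w‖ < 1 :=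
      Filter.Eventually.filter_mono nhdsWithin_le_nhds
        ((continuous_const.mul continuous_norm).continuousAt.eventually_lt_const hz)
    filter_upwards [hev, self_mem_nhdsWithin] with w hw hne
    have hpos : 0 < ‖w - z‖ ^ m := by
      have : w - z ≠ 0 := sub_ne_zero.2 hne
      positivity
    have := norm_eval_derivative_le_of_newton_recursion hR hrec hS hw
    rw [hQ] at this
    rw [hP] at this
    simp only [Nat.add_sub_cancel, eval_mul, eval_pow, eval_sub, eval_X, eval_C, norm_mul,
      norm_pow] at this
    refine le_of_mul_le_mul_left (this.trans (le_of_eq ?_)) hpos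
    ring
  simpa using h3

theorem norm_le_of_newton_recursion {A S : ℕ → ℂ} {M : ℕ} {R B : ℝ} (hR : 0 < R)
    (hA0 : A 0 = 1) (hAM : ∀ d, M < d → A d = 0)
    (hrec : ∀ d : ℕ, ((d : ℂ) + 1) * A (d + 1) =
      ∑ x ∈ Finset.HasAntidiagonal.antidiagonal d, S (x.1 + 1) * A x.2)
    (hS : ∀ n, ‖S (n + 1)‖ ≤ B * R ^ (n + 1)) : ‖S 1‖ ≤ M * R := by
  have hS1 : S 1 = A 1 := by simpa [hA0] using (hrec 0).symm
  rw [hS1]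
  obtain rfl | hM := Nat.eq_zero_or_pos M
  · simp [hAM 1]
  set L : ℂ[X] := ∑ d ∈ Finset.range (M + 1), C (A d) * X ^ d with hLdef
  have hLc : ∀ d, L.coeff d = A d := fun d => by
    simp only [hLdef, finsetSum_coeff, coeff_C_mul, coeff_X_pow, mul_ite, mul_one, mul_zero,
      Finset.sum_ite_eq, Finset.mem_range]
    split_ifs with h
    · rfl
    · exact (hAM d (by omega)).symm
  have hL0 : L ≠ 0 := fun h => by have := hLc 0; simp [h, hA0] at this
  have hLd : L.natDegree ≤ M := natDegree_le_iff_coeff_eq_zero.2 fun d hd => by rw [hLc, hAM d hd]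
  set r := reflect M L with hr
  have hrd : r.natDegree ≤ M := natDegree_le_iff_coeff_eq_zero.2 fun d hd => by
    rw [hr, coeff_reflect, revAt_eq_self_of_lt hd, hLc, hAM d hd]
  have hrM : r.coeff M = 1 := by rw [hr, coeff_reflect, revAt_le le_rfl, Nat.sub_self, hLc, hA0]
  have hrmon : r.Monic := monic_of_natDegree_le_of_coeff_eq_one M hrd hrM
  have hrdeg : r.natDegree = M := natDegree_eq_of_le_of_coeff_ne_zero hrd (by simp [hrM])
  have hsum := (IsAlgClosed.splits r).nextCoeff_eq_neg_sum_roots_of_monic hrmon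
  rw [nextCoeff_of_natDegree_pos (by omega), hrdeg, hr, coeff_reflect, revAt_le (by omega),
    hLc, show M - (M - 1) = 1 by omega] at hsum
  rw [hsum, norm_neg, ← hr]
  have hroots : ∀ w ∈ r.roots, ‖w‖ ≤ R := by
    intro w hw
    by_contra! hlt
    have hw0 : w ≠ 0 := by rintro rfl; simp at hlt; linarith
    have hz : R * ‖w⁻¹‖ < 1 := by
      rw [norm_inv, ← div_eq_mul_inv, div_lt_one (hR.trans hlt)]
      exact hlt
    refine eval_ne_zero_of_newton_recursion hL0 hR (by simpa [hLc] using hrec) hS hz ?_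
    have hLr : reflect M r = L := by rw [hr, reflect_reflect]
    let _ := invertibleOfNonzero hw0
    have h1 := (eval₂_reflect_eq_zero_iff (RingHom.id ℂ) w M r hrd).2 (isRoot_of_mem_roots hw)
    rwa [hLr, invOf_eq_inv] at h1
  calc ‖r.roots.sum‖ ≤ (r.roots.map norm).sum := norm_multiset_sum_le _
    _ ≤ Multiset.card (r.roots.map norm) • R := Multiset.sum_le_card_nsmul _ _ (by simpa only [Multiset.mem_map, forall_exists_index, and_imp, forall_apply_eq_imp_iff₂] using hroots)
    _ ≤ M * R := by
        rw [Multiset.card_map, nsmul_eq_mul]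
        gcongr
        exact (card_roots' _).trans hrd

section
variable (F : Type*) [Field F] [Finite F]

theorem finite_setOf_monic_natDegree_eq (d : ℕ) :
    {h : F[X] | h.Monic ∧ h.natDegree = d}.Finite := by
  have : Finite (degreeLT F (d + 1)) := Finite.of_equiv _ (degreeLTEquiv F (d + 1)).symm.toEquiv
  refine (Set.toFinite (degreeLT F (d + 1) : Set F[X])).subset fun h hh => ?_
  rw [SetLike.mem_coe, mem_degreeLT, degree_eq_natDegree hh.1.ne_zero, hh.2]
  exact_mod_cast Nat.lt_succ_self d

/-- The monic polynomials of degree `d` over a finite field. -/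
noncomputable def monicsOfDegree (d : ℕ) : Finset F[X] :=
  (finite_setOf_monic_natDegree_eq F d).toFinset

open Classical in
/-- The monic irreducible polynomials of degree at most `d` over a finite field. -/
noncomputable def monicPrimes (d : ℕ) : Finset F[X] :=
  ((Finset.range (d + 1)).biUnion (monicsOfDegree F)).filter Irreducible

end

section
variable {F : Type*} [Field F] [Finite F]

@[simp] theorem mem_monicsOfDegree {d : ℕ} {h : F[X]} :
    h ∈ monicsOfDegree F d ↔ h.Monic ∧ h.natDegree = d := by
  simp [monicsOfDegree]

@[simp] theorem mem_monicPrimes {d : ℕ} {P : F[X]} :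
    P ∈ monicPrimes F d ↔ P.Monic ∧ Irreducible P ∧ P.natDegree ≤ d := by
  simp [monicPrimes]
  tauto

/-- The coefficient of `T ^ d` in the `L`-series of `l`. -/
noncomputable def lCoeff (l : F[X] →* ℂ) (d : ℕ) : ℂ := ∑ h ∈ monicsOfDegree F d, l h

/-- The coefficient of `T ^ n` in `T` times the logarithmic derivative of the `L`-series of `l`. -/
noncomputable def lPowerSum (l : F[X] →* ℂ) (n : ℕ) : ℂ :=
  ∑ P ∈ monicPrimes F n with P.natDegree ∣ n, P.natDegree * l P ^ (n / P.natDegree)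

theorem lCoeff_zero (l : F[X] →* ℂ) : lCoeff l 0 = 1 := by
  have : monicsOfDegree F 0 = {1} := by
    ext h
    simp only [mem_monicsOfDegree, Finset.mem_singleton]
    constructor
    · rintro ⟨h1, h2⟩
      exact h1.natDegree_eq_zero.1 h2
    · rintro rfl
      simp
  simp [lCoeff, this]

open Classical in
theorem sum_filter_dvd_eq_mul_lCoeff (l : F[X] →* ℂ) {Q : F[X]} (hQ : Q.Monic) {d : ℕ}
    (hd : Q.natDegree ≤ d) :
    ∑ h ∈ monicsOfDegree F d with Q ∣ h, l h = l Q * lCoeff l (d - Q.natDegree) := by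
  rw [lCoeff, Finset.mul_sum]
  refine (Finset.sum_bij (fun h _ => Q * h) ?_ ?_ ?_ ?_).symm
  · intro h hh
    rw [mem_monicsOfDegree] at hh
    simp only [Finset.mem_filter, mem_monicsOfDegree, dvd_mul_right, and_true]
    refine ⟨hQ.mul hh.1, ?_⟩
    rw [hQ.natDegree_mul hh.1, hh.2]
    omega
  · intro a _ b _ hab
    exact mul_left_cancel₀ hQ.ne_zero hab
  · intro h hh
    simp only [Finset.mem_filter, mem_monicsOfDegree] at hh
    obtain ⟨⟨hm, hdeg⟩, c, rfl⟩ := hh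
    have hc := hQ.of_mul_monic_left hm
    rw [hQ.natDegree_mul hc] at hdeg
    exact ⟨c, by simp only [mem_monicsOfDegree]; exact ⟨hc, by omega⟩, rfl⟩
  · intro h _
    rw [map_mul]

open Classical in
theorem natDegree_eq_sum_card_pow_dvd {h : F[X]} (hh : h.Monic) :
    h.natDegree = ∑ P ∈ monicPrimes F h.natDegree,
      P.natDegree * ((Finset.Icc 1 h.natDegree).filter fun j => P ^ j ∣ h).card := by
  have h0 := hh.ne_zero
  set s := UniqueFactorizationMonoid.normalizedFactors h with hs
  have hprod : s.prod = h := by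
    have h1 := UniqueFactorizationMonoid.prod_normalizedFactors_eq h0
    rwa [hh.normalize_eq_self] at h1
  have hmon : ∀ P ∈ s, P.Monic := fun P hP => by
    rw [← UniqueFactorizationMonoid.normalize_normalized_factor P hP]
    exact monic_normalize (UniqueFactorizationMonoid.irreducible_of_normalized_factor P hP).ne_zero
  have hdeg : h.natDegree = (s.map natDegree).sum := by
    conv_lhs => rw [← hprod]
    exact natDegree_multiset_prod_of_monic _ hmon
  have hsub : s.toFinset ⊆ monicPrimes F h.natDegree := fun P hP => by
    rw [Multiset.mem_toFinset] at hP
    exact mem_monicPrimes.2 ⟨hmon P hP,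
      UniqueFactorizationMonoid.irreducible_of_normalized_factor P hP,
      natDegree_le_of_dvd (UniqueFactorizationMonoid.dvd_of_mem_normalizedFactors hP) h0⟩
  conv_lhs => rw [hdeg, Finset.sum_multiset_map_count]
  rw [Finset.sum_subset hsub fun P _ hP => by
    rw [Multiset.count_eq_zero_of_notMem (by simpa using hP), zero_smul]]
  refine Finset.sum_congr rfl fun P hP => ?_
  obtain ⟨hPm, hPi, -⟩ := mem_monicPrimes.1 hP
  have hPd : 0 < P.natDegree := hPi.natDegree_pos
  have hdvd : ∀ j, P ^ j ∣ h ↔ j ≤ s.count P := fun j => by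
    rw [pow_dvd_iff_le_emultiplicity,
      UniqueFactorizationMonoid.emultiplicity_eq_count_normalizedFactors hPi h0,
      hPm.normalize_eq_self, Nat.cast_le]
  have hle : s.count P ≤ h.natDegree := by
    have h1 := natDegree_le_of_dvd ((hdvd _).2 le_rfl) h0
    rw [natDegree_pow] at h1
    nlinarith
  have : (Finset.Icc 1 h.natDegree).filter (fun j => P ^ j ∣ h) = Finset.Icc 1 (s.count P) := by
    ext j
    simp only [Finset.mem_filter, Finset.mem_Icc, hdvd]
    omega
  rw [this, Nat.card_Icc, smul_eq_mul, mul_comm, Nat.add_sub_cancel]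

open Classical in
theorem sum_sum_filter_pow_dvd (l : F[X] →* ℂ) {P : F[X]}
    (hP : P.Monic) (hP0 : 0 < P.natDegree) (d : ℕ) :
    ∑ j ∈ Finset.Icc 1 d, ∑ h ∈ monicsOfDegree F d with P ^ j ∣ h, l h =
      ∑ n ∈ Finset.Icc 1 d with P.natDegree ∣ n,
        l P ^ (n / P.natDegree) * lCoeff l (d - n) := by
  have h1 : ∀ j ∈ Finset.Icc 1 d, j ∉ (Finset.Icc 1 d).filter (fun j => j * P.natDegree ≤ d) →
      ∑ h ∈ monicsOfDegree F d with P ^ j ∣ h, l h = 0 := by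
    intro j hj hj'
    refine Finset.sum_eq_zero fun h hh => ?_
    simp only [Finset.mem_filter, mem_monicsOfDegree] at hh
    have h2 := natDegree_le_of_dvd hh.2 hh.1.1.ne_zero
    rw [natDegree_pow, hh.1.2] at h2
    exact absurd (Finset.mem_filter.2 ⟨hj, h2⟩) hj'
  rw [← Finset.sum_subset (Finset.filter_subset (fun j => j * P.natDegree ≤ d) _) h1]
  refine Finset.sum_bij (fun j _ => j * P.natDegree) ?_ ?_ ?_ ?_
  · intro j hj
    simp only [Finset.mem_filter, Finset.mem_Icc] at hj ⊢
    exact ⟨⟨Nat.mul_pos hj.1.1 hP0, hj.2⟩, dvd_mul_left _ _⟩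
  · intro a _ b _ hab
    exact Nat.eq_of_mul_eq_mul_right hP0 hab
  · intro n hn
    simp only [Finset.mem_filter, Finset.mem_Icc] at hn
    obtain ⟨⟨h1, h2⟩, j, rfl⟩ := hn
    refine ⟨j, ?_, mul_comm _ _⟩
    simp only [Finset.mem_filter, Finset.mem_Icc]
    refine ⟨⟨?_, ?_⟩, ?_⟩ <;> nlinarith
  · intro j hj
    have hj := (Finset.mem_filter.1 hj).2
    rw [Nat.mul_div_cancel _ hP0, ← map_pow, ← natDegree_pow]
    exact sum_filter_dvd_eq_mul_lCoeff l (hP.pow j) (by rwa [natDegree_pow])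

theorem natCast_mul_lCoeff (l : F[X] →* ℂ) (d : ℕ) :
    d * lCoeff l d = ∑ n ∈ Finset.Icc 1 d, lPowerSum l n * lCoeff l (d - n) := by
  classical
  have hl : ∀ h ∈ monicsOfDegree F d, (d : ℂ) * l h = ∑ P ∈ monicPrimes F d,
      (P.natDegree : ℂ) * ∑ j ∈ Finset.Icc 1 d, if P ^ j ∣ h then l h else 0 := by
    intro h hh
    obtain ⟨hm, rfl⟩ := mem_monicsOfDegree.1 hh
    conv_lhs => rw [natDegree_eq_sum_card_pow_dvd hm]
    rw [Nat.cast_sum, Finset.sum_mul]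
    refine Finset.sum_congr rfl fun P _ => ?_
    rw [← Finset.sum_filter, Finset.sum_const, nsmul_eq_mul]
    push_cast
    ring
  rw [lCoeff, Finset.mul_sum, Finset.sum_congr rfl hl, Finset.sum_comm]
  have hr : ∀ n ∈ Finset.Icc 1 d, lPowerSum l n * lCoeff l (d - n) = ∑ P ∈ monicPrimes F d,
      (P.natDegree : ℂ) * if P.natDegree ∣ n then
        l P ^ (n / P.natDegree) * lCoeff l (d - n) else 0 := by
    intro n hn
    rw [Finset.mem_Icc] at hn
    have : (monicPrimes F n).filter (fun P => P.natDegree ∣ n) =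
        (monicPrimes F d).filter (fun P => P.natDegree ∣ n) := by
      ext P
      simp only [Finset.mem_filter, mem_monicPrimes]
      refine and_congr_left fun h => and_congr_right fun _ => and_congr_right fun _ => ?_
      have := Nat.le_of_dvd hn.1 h
      omega
    rw [lPowerSum, this, Finset.sum_mul, Finset.sum_filter]
    refine Finset.sum_congr rfl fun P _ => ?_
    split_ifs <;> ring
  rw [Finset.sum_congr rfl hr, Finset.sum_comm (s := Finset.Icc 1 d)]
  refine Finset.sum_congr rfl fun P hP => ?_
  obtain ⟨hPm, hPi, -⟩ := mem_monicPrimes.1 hP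
  rw [← Finset.mul_sum, ← Finset.mul_sum, ← Finset.sum_filter,
    ← sum_sum_filter_pow_dvd l hPm hPi.natDegree_pos, Finset.sum_comm]
  simp only [Finset.sum_filter]

theorem succ_mul_lCoeff_succ (l : F[X] →* ℂ) (d : ℕ) :
    ((d : ℂ) + 1) * lCoeff l (d + 1) =
      ∑ x ∈ Finset.HasAntidiagonal.antidiagonal d, lPowerSum l (x.1 + 1) * lCoeff l x.2 := by
  have h := natCast_mul_lCoeff l (d + 1)
  push_cast at h
  rw [h, Finset.Nat.sum_antidiagonal_eq_sum_range_succ (fun i j => lPowerSum l (i + 1) * lCoeff l j),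
    ← Finset.Ico_add_one_right_eq_Icc, Finset.sum_Ico_eq_sum_range]
  refine Finset.sum_congr rfl fun i _ => ?_
  rw [add_comm 1 i, Nat.add_sub_add_right]

open Classical in
/-- The elements of the degree `n` extension of `F` inside an extension field `K`. -/
noncomputable def frobeniusFixed (F K : Type*) [Field F] [Field K] (n : ℕ) : Finset K :=
  (X ^ Nat.card F ^ n - X : K[X]).roots.toFinset

theorem mem_frobeniusFixed {K : Type*} [Field K] {n : ℕ} (hn : n ≠ 0) {x : K} :
    x ∈ frobeniusFixed F K n ↔ x ^ Nat.card F ^ n = x := by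
  classical
  rw [frobeniusFixed, Multiset.mem_toFinset,
    mem_roots (FiniteField.X_pow_card_pow_sub_X_ne_zero K hn Finite.one_lt_card)]
  simp [sub_eq_zero]

theorem pow_card_pow_eq_iff {K : Type*} [Field K] [Algebra F K] [Algebra.IsAlgebraic F K]
    {n : ℕ} {x : K} :
    x ^ Nat.card F ^ n = x ↔ (minpoly F x).natDegree ∣ n := by
  rw [(minpoly.irreducible (Algebra.IsIntegral.isIntegral (R := F) x)
    ).natDegree_dvd_iff_dvd_X_pow_card_pow_sub_X, minpoly.dvd_iff]
  simp [sub_eq_zero]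

theorem lPowerSum_eq_sum_frobeniusFixed (K : Type*) [Field K] [Algebra F K] [IsAlgClosure F K]
    (l : F[X] →* ℂ) {n : ℕ} (hn : n ≠ 0) :
    lPowerSum l n = ∑ x ∈ frobeniusFixed F K n,
      l (minpoly F x) ^ (n / (minpoly F x).natDegree) := by
  classical
  have : Algebra.IsAlgebraic F K := IsAlgClosure.isAlgebraic
  have : IsAlgClosed K := IsAlgClosure.isAlgClosed F
  have hint : ∀ x : K, IsIntegral F x := fun x => Algebra.IsIntegral.isIntegral x
  have hmap : ∀ x ∈ frobeniusFixed F K n,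
      minpoly F x ∈ (monicPrimes F n).filter fun P => P.natDegree ∣ n := by
    intro x hx
    rw [mem_frobeniusFixed hn, pow_card_pow_eq_iff] at hx
    simp only [Finset.mem_filter, mem_monicPrimes]
    exact ⟨⟨minpoly.monic (hint x), minpoly.irreducible (hint x),
      Nat.le_of_dvd (Nat.pos_of_ne_zero hn) hx⟩, hx⟩
  rw [← Finset.sum_fiberwise_of_maps_to hmap, lPowerSum]
  refine Finset.sum_congr rfl fun P hP => ?_
  simp only [Finset.mem_filter, mem_monicPrimes] at hP
  obtain ⟨⟨hPm, hPi, -⟩, hPn⟩ := hP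
  have hfib : (frobeniusFixed F K n).filter (fun x => minpoly F x = P) =
      (P.aroots K).toFinset := by
    ext x
    simp only [Finset.mem_filter, mem_frobeniusFixed hn, Multiset.mem_toFinset, mem_aroots]
    constructor
    · rintro ⟨-, rfl⟩
      exact ⟨hPi.ne_zero, minpoly.aeval F x⟩
    · rintro ⟨-, hx⟩
      have hx' := minpoly.eq_of_irreducible_of_monic hPi hx hPm
      refine ⟨?_, hx'.symm⟩
      rw [pow_card_pow_eq_iff, ← hx']
      exact hPn
  have hsep : P.Separable := PerfectField.separable_of_irreducible hPi
  have hcard : (P.aroots K).toFinset.card = P.natDegree := by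
    rw [Multiset.toFinset_card_of_nodup (nodup_aroots_iff_of_splits hPi.ne_zero
      (IsAlgClosed.splits _) |>.2 hsep)]
    rw [aroots, ← (IsAlgClosed.splits _).natDegree_eq_card_roots, natDegree_map]
  rw [Finset.sum_congr rfl (g := fun _ => l P ^ (n / P.natDegree)) fun x hx => by
    rw [(Finset.mem_filter.1 hx).2], Finset.sum_const, hfib, hcard, nsmul_eq_mul]

end

theorem Multiset.sum_map_pow_eq_mul_esymm_sub_sum {R : Type*} [CommRing R] (s : Multiset R)
    {k : ℕ} (hk : 0 < k) :
    (s.map (· ^ k)).sum = (-1) ^ (k + 1) * k * s.esymm k -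
      ∑ a ∈ Finset.HasAntidiagonal.antidiagonal k with a.1 ∈ Set.Ioo 0 k,
        (-1) ^ a.1 * s.esymm a.1 * (s.map (· ^ a.2)).sum := by
  obtain ⟨n, f, rfl⟩ : ∃ (n : ℕ) (f : Fin n → R), s = Finset.univ.val.map f := by
    induction s using Quotient.inductionOn with
    | h L => exact ⟨L.length, L.get, by simp [Fin.univ_val_map]⟩
  have hp : ∀ j, MvPolynomial.aeval f (MvPolynomial.psum (Fin n) R j) =
      ((Finset.univ.val.map f).map (· ^ j)).sum := fun j => by
    simp only [MvPolynomial.psum, map_sum, map_pow, MvPolynomial.aeval_X, Multiset.map_map]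
    rfl
  have h := congrArg (MvPolynomial.aeval f) (MvPolynomial.psum_eq_mul_esymm_sub_sum (Fin n) R k hk)
  simpa only [map_sub, map_sum, map_mul, map_pow, map_neg, map_one, map_natCast, hp,
    MvPolynomial.aeval_esymm_eq_multiset_esymm] using h

theorem Multiset.sum_map_pow_sub_sum_map_pow {R : Type*} [CommRing R] {s s' : Multiset R}
    {N : ℕ} (hN : 0 < N) (h : ∀ j < N, s'.esymm j = s.esymm j)
    (h' : ∀ j < N, (s'.map (· ^ j)).sum = (s.map (· ^ j)).sum) :
    (s'.map (· ^ N)).sum - (s.map (· ^ N)).sum =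
      (-1) ^ (N + 1) * N * (s'.esymm N - s.esymm N) := by
  rw [Multiset.sum_map_pow_eq_mul_esymm_sub_sum s hN, Multiset.sum_map_pow_eq_mul_esymm_sub_sum s' hN]
  have : ∑ a ∈ Finset.HasAntidiagonal.antidiagonal N with a.1 ∈ Set.Ioo 0 N,
        (-1) ^ a.1 * s'.esymm a.1 * (s'.map (· ^ a.2)).sum =
      ∑ a ∈ Finset.HasAntidiagonal.antidiagonal N with a.1 ∈ Set.Ioo 0 N,
        (-1) ^ a.1 * s.esymm a.1 * (s.map (· ^ a.2)).sum := by
    refine Finset.sum_congr rfl fun a ha => ?_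
    simp only [Finset.mem_filter, Finset.HasAntidiagonal.mem_antidiagonal, Set.mem_Ioo] at ha
    rw [h _ ha.2.2, h' _ (by omega)]
  rw [this]
  ring

theorem Multiset.sum_map_pow_eq_of_esymm_eq {R : Type*} [CommRing R] {s s' : Multiset R}
    (hcard : s'.card = s.card) {N : ℕ} (h : ∀ j < N, s'.esymm j = s.esymm j) :
    ∀ j < N, (s'.map (· ^ j)).sum = (s.map (· ^ j)).sum := by
  intro j
  induction j using Nat.strong_induction_on with
  | _ j ih =>
    intro hj
    rcases Nat.eq_zero_or_pos j with rfl | hj0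
    · simp [hcard]
    · have := Multiset.sum_map_pow_sub_sum_map_pow hj0 (fun i hi => h i (hi.trans hj))
        fun i hi => ih i hi (hi.trans hj)
      rwa [h j hj, sub_self, mul_zero, sub_eq_zero] at this

theorem Multiset.esymm_eq_coeff {R : Type*} [CommRing R] (s : Multiset R) {j : ℕ}
    (hj : j ≤ s.card) :
    s.esymm j = (-1) ^ j * (s.map fun x => X - C x).prod.coeff (s.card - j) := by
  rw [Multiset.prod_X_sub_C_coeff s (Nat.sub_le _ _), Nat.sub_sub_self hj, ← mul_assoc, ← pow_add,
    Even.neg_one_pow ⟨j, rfl⟩, one_mul]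

theorem reverse_prod_X_sub_C {K : Type*} [Field K] {s : Multiset K} (hs : 0 ∉ s) :
    (s.map fun x => X - C x).prod.reverse =
      C ((s.map fun x => X - C x).prod.coeff 0) *
        ((s.map (·⁻¹)).map fun x => X - C x).prod := by
  induction s using Multiset.induction with
  | empty => simpa using reverse_C (1 : K)
  | cons a s ih =>
    rw [Multiset.mem_cons, not_or] at hs
    have ha : a ≠ 0 := fun h => hs.1 h.symm
    simp only [Multiset.map_cons, Multiset.prod_cons, reverse_mul_of_domain, ih hs.2,
      mul_coeff_zero]
    have : (X - C a : K[X]).reverse = C (-a) * (X - C a⁻¹) := by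
      rw [reverse, natDegree_X_sub_C, mul_sub, ← C_mul, neg_mul, mul_inv_cancel₀ ha, reflect_sub,
        reflect_C, ← pow_one (X : K[X]), reflect_monomial, revAt_le le_rfl]
      simp
      ring
    rw [this]
    simp only [coeff_sub, coeff_X_zero, coeff_C_zero, zero_sub, C_mul]
    ring

theorem esymm_map_inv {K : Type*} [Field K] {s : Multiset K} (hs : 0 ∉ s) {j : ℕ}
    (hj : j ≤ s.card) :
    (s.map (·⁻¹)).esymm j = (-1) ^ j * ((s.map fun x => X - C x).prod.coeff j /
      (s.map fun x => X - C x).prod.coeff 0) := by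
  have h := congrArg (fun P => P.coeff (s.card - j)) (reverse_prod_X_sub_C hs)
  have h0 : (s.map fun x => X - C x).prod.coeff 0 ≠ 0 := by
    rw [coeff_zero_eq_eval_zero, eval_multiset_prod]
    simpa using hs
  simp only [coeff_C_mul, coeff_reverse, natDegree_multiset_prod_X_sub_C_eq_card] at h
  rw [revAt_le (Nat.sub_le _ _), Nat.sub_sub_self hj] at h
  rw [Multiset.esymm_eq_coeff _ (by simpa using hj), Multiset.card_map, h,
    mul_div_cancel_left₀ _ h0]

section
variable {F : Type*} [Field F] {K : Type*} [Field K] [Algebra F K]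

open Classical in
/-- The multiplicative function sending a polynomial `h` to the value of the additive character
`χ` at the sum of `G` over the roots of `h`, or to zero if zero is such a root. -/
noncomputable def rootCharacter (F : Type*) [Field F] {K : Type*} [Field K] [Algebra F K]
    (χ : AddChar K ℂ) (G : K → K) : F[X] →* ℂ where
  toFun h := if h.coeff 0 = 0 then 0 else χ ((h.aroots K).map G).sum
  map_one' := by simp
  map_mul' a b := by
    by_cases ha : a.coeff 0 = 0
    · simp [ha]
    by_cases hb : b.coeff 0 = 0
    · simp [hb]
    have hab : a * b ≠ 0 := by
      intro h
      have := congrArg (fun P => P.coeff 0) h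
      simp [ha, hb] at this
    simp [ha, hb, aroots_mul hab, AddChar.map_add_eq_mul]

theorem rootCharacter_apply_of_coeff_zero_eq_zero (χ : AddChar K ℂ) (G : K → K) {h : F[X]}
    (h0 : h.coeff 0 = 0) : rootCharacter F χ G h = 0 := if_pos h0

theorem rootCharacter_apply_of_coeff_zero_ne_zero (χ : AddChar K ℂ) (G : K → K) {h : F[X]}
    (h0 : h.coeff 0 ≠ 0) : rootCharacter F χ G h = χ ((h.aroots K).map G).sum := if_neg h0

theorem rootCharacter_minpoly_zero (χ : AddChar K ℂ) (G : K → K) :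
    rootCharacter F χ G (minpoly F (0 : K)) = 0 :=
  rootCharacter_apply_of_coeff_zero_eq_zero _ _ (by simp)

theorem sum_map_div_pow (g : F[X]) {D E : ℕ} (hg : g.natDegree = D + E) {s : Multiset K}
    (hs : 0 ∉ s) :
    (s.map fun x => aeval x g / x ^ E).sum =
      ∑ i ∈ Finset.range E, algebraMap F K (g.coeff i) * ((s.map (·⁻¹)).map (· ^ (E - i))).sum +
      ∑ j ∈ Finset.range (D + 1), algebraMap F K (g.coeff (E + j)) * (s.map (· ^ j)).sum := by
  induction s using Multiset.induction with
  | empty => simp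
  | cons x s ih =>
    rw [Multiset.mem_cons, not_or] at hs
    have hx : x ≠ 0 := fun h => hs.1 h.symm
    simp only [Multiset.map_cons, Multiset.sum_cons, mul_add, Finset.sum_add_distrib, ih hs.2]
    rw [add_add_add_comm, aeval_eq_sum_range, hg, Finset.sum_div,
      show D + E + 1 = E + (D + 1) by ring, Finset.sum_range_add]
    congr 2 <;> refine Finset.sum_congr rfl fun i hi => ?_
    · rw [Finset.mem_range] at hi
      rw [Algebra.smul_def, inv_pow, mul_div_assoc, pow_sub₀ _ hx hi.le, mul_inv, inv_inv,
        div_eq_inv_mul]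
    · rw [Algebra.smul_def, pow_add, mul_div_assoc, mul_div_cancel_left₀ _ (pow_ne_zero _ hx)]

theorem sum_map_aroots_add_C_mul_X_pow [IsAlgClosed K] {g : F[X]} {D E d : ℕ}
    (hg : g.natDegree = D + E) (hD : 0 < D) (hd : D + E < d) {h : F[X]} (hm : h.Monic)
    (hhd : h.natDegree = d) (h0 : h.coeff 0 ≠ 0) (δ : F) :
    (((h + C δ * X ^ (d - D)).aroots K).map fun x => aeval x g / x ^ E).sum =
      ((h.aroots K).map fun x => aeval x g / x ^ E).sum +
        algebraMap F K (-D * g.leadingCoeff * δ) := by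
  set h' := h + C δ * X ^ (d - D) with hh'
  have hlt : (C δ * X ^ (d - D)).degree < h.degree := by
    rw [degree_eq_natDegree hm.ne_zero, hhd]
    refine (degree_C_mul_X_pow_le _ _).trans_lt ?_
    exact_mod_cast (by omega : d - D < d)
  have hm' : h'.Monic := hm.add_of_left hlt
  have hhd' : h'.natDegree = d := by rw [hh', natDegree_add_eq_left_of_degree_lt hlt, hhd]
  have hcoeff : ∀ j, j ≠ d - D → h'.coeff j = h.coeff j := fun j hj => by
    simp [hh', coeff_C_mul, coeff_X_pow, hj]
  have hcoeffD : h'.coeff (d - D) = h.coeff (d - D) + δ := by simp [hh']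
  have h0' : h'.coeff 0 ≠ 0 := by rwa [hcoeff 0 (by omega)]
  have key : ∀ P : F[X], P.Monic → P.natDegree = d → P.coeff 0 ≠ 0 →
      (P.aroots K).card = d ∧ 0 ∉ P.aroots K ∧
        ((P.aroots K).map fun x => X - C x).prod = P.map (algebraMap F K) := by
    intro P hP hPd hP0
    have hc : (P.map (algebraMap F K)).natDegree = (P.aroots K).card :=
      (IsAlgClosed.splits _).natDegree_eq_card_roots
    refine ⟨by rw [← hc, natDegree_map, hPd], ?_, ?_⟩
    · rw [mem_aroots]
      rintro ⟨-, h⟩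
      rw [← coeff_zero_eq_aeval_zero'] at h
      exact hP0 (by simpa using h)
    · exact prod_multiset_X_sub_C_of_monic_of_roots_card_eq (hP.map _) hc.symm
  obtain ⟨hs1, hs2, hs3⟩ := key h hm hhd h0
  obtain ⟨hs1', hs2', hs3'⟩ := key h' hm' hhd' h0'
  set s := h.aroots K
  set s' := h'.aroots K
  have he : ∀ j < D, s'.esymm j = s.esymm j := fun j hj => by
    rw [Multiset.esymm_eq_coeff _ (by omega), Multiset.esymm_eq_coeff _ (by omega), hs3, hs3',
      hs1, hs1', coeff_map, coeff_map, hcoeff _ (by omega)]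
  have heD : s'.esymm D - s.esymm D = (-1) ^ D * algebraMap F K δ := by
    rw [Multiset.esymm_eq_coeff _ (by omega), Multiset.esymm_eq_coeff _ (by omega), hs3, hs3',
      hs1, hs1', coeff_map, coeff_map, hcoeffD, map_add]
    ring
  have hei : ∀ j < E + 1, (s'.map (·⁻¹)).esymm j = (s.map (·⁻¹)).esymm j := fun j hj => by
    rw [esymm_map_inv hs2 (by omega), esymm_map_inv hs2' (by omega), hs3, hs3', coeff_map,
      coeff_map, coeff_map, coeff_map, hcoeff j (by omega), hcoeff 0 (by omega)]
  have hp := Multiset.sum_map_pow_eq_of_esymm_eq (by rw [hs1, hs1']) he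
  have hpi := Multiset.sum_map_pow_eq_of_esymm_eq (by simp [hs1, hs1']) hei
  have hpD := Multiset.sum_map_pow_sub_sum_map_pow hD he hp
  rw [heD, sub_eq_iff_eq_add] at hpD
  rw [sum_map_div_pow g hg hs2, sum_map_div_pow g hg hs2', Finset.sum_range_succ,
    Finset.sum_range_succ _ D, hpD]
  have e1 : ∀ i ∈ Finset.range E, algebraMap F K (g.coeff i) *
      ((s'.map (·⁻¹)).map (· ^ (E - i))).sum =
      algebraMap F K (g.coeff i) * ((s.map (·⁻¹)).map (· ^ (E - i))).sum := fun i _ => by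
    rw [hpi _ (by omega)]
  have e2 : ∀ j ∈ Finset.range D, algebraMap F K (g.coeff (E + j)) * (s'.map (· ^ j)).sum =
      algebraMap F K (g.coeff (E + j)) * (s.map (· ^ j)).sum := fun j hj => by
    rw [hp _ (Finset.mem_range.1 hj)]
  rw [Finset.sum_congr rfl e1, Finset.sum_congr rfl e2]
  have hsign : ((-1 : K) ^ (D + 1)) * (-1) ^ D = -1 := by
    rw [← pow_add, show D + 1 + D = 2 * D + 1 by ring, pow_succ, pow_mul]
    simp
  rw [leadingCoeff, hg, add_comm E D]
  simp only [map_mul, map_neg, map_natCast]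
  linear_combination (algebraMap F K (g.coeff (D + E)) * D * algebraMap F K δ) * hsign

theorem lCoeff_rootCharacter_eq_zero [Finite F] [IsAlgClosed K] {χ : AddChar K ℂ}
    (hχ : ∃ b : F, χ (algebraMap F K b) ≠ 1) {g : F[X]} {D E d : ℕ}
    (hg : g.natDegree = D + E) (hD : (D : F) ≠ 0) (hd : D + E < d) :
    lCoeff (rootCharacter F χ fun x => aeval x g / x ^ E) d = 0 := by
  obtain ⟨b, hb⟩ := hχ
  have hD0 : 0 < D := Nat.pos_of_ne_zero (by rintro rfl; simp at hD)
  have hlead : g.leadingCoeff ≠ 0 := by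
    rw [Ne, leadingCoeff_eq_zero]
    rintro rfl
    rw [natDegree_zero] at hg
    omega
  obtain ⟨δ, hδ⟩ : ∃ δ : F, -D * g.leadingCoeff * δ = b :=
    ⟨(-D * g.leadingCoeff)⁻¹ * b, by field_simp⟩
  set l := rootCharacter F χ fun x => aeval x g / x ^ E with hl
  have hcoeff0 : ∀ h : F[X], (h + C δ * X ^ (d - D)).coeff 0 = h.coeff 0 := fun h => by
    simp [coeff_X_pow, show 0 ≠ d - D by omega]
  have hmem : ∀ h : F[X], ∀ ε : F, h ∈ monicsOfDegree F d →
      h + C ε * X ^ (d - D) ∈ monicsOfDegree F d := by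
    intro h ε hh
    rw [mem_monicsOfDegree] at hh ⊢
    have hlt : (C ε * X ^ (d - D)).degree < h.degree := by
      rw [degree_eq_natDegree hh.1.ne_zero, hh.2]
      refine (degree_C_mul_X_pow_le _ _).trans_lt ?_
      exact_mod_cast (by omega : d - D < d)
    exact ⟨hh.1.add_of_left hlt, by rw [natDegree_add_eq_left_of_degree_lt hlt, hh.2]⟩
  have hshift : lCoeff l d = lCoeff l d * χ (algebraMap F K b) := by
    conv_lhs => rw [lCoeff]
    rw [lCoeff, Finset.sum_mul]
    refine (Finset.sum_bij (fun h _ => h + C δ * X ^ (d - D)) (fun h hh => hmem h δ hh)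
      (fun _ _ _ _ h => add_right_cancel h) ?_ ?_).symm
    · intro h hh
      exact ⟨h + C (-δ) * X ^ (d - D), hmem h (-δ) hh, by simp⟩
    · intro h hh
      rw [mem_monicsOfDegree] at hh
      by_cases h0 : h.coeff 0 = 0
      · rw [hl, rootCharacter_apply_of_coeff_zero_eq_zero _ _ h0,
          rootCharacter_apply_of_coeff_zero_eq_zero _ _ (by rw [hcoeff0, h0]), zero_mul]
      · rw [hl, rootCharacter_apply_of_coeff_zero_ne_zero _ _ h0,
          rootCharacter_apply_of_coeff_zero_ne_zero _ _ (by rwa [hcoeff0]),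
          sum_map_aroots_add_C_mul_X_pow hg hD0 hd hh.1 hh.2 h0, hδ, AddChar.map_add_eq_mul]
  have : lCoeff l d * (1 - χ (algebraMap F K b)) = 0 := by linear_combination hshift
  exact (mul_eq_zero.1 this).resolve_right (sub_ne_zero.2 (Ne.symm hb))

end

section
variable {F : Type*} [Field F] [Finite F] {K : Type*} [Field K] [Algebra F K]

theorem exists_algHom_apply_eq_pow_card_pow (F : Type*) [Field F] [Finite F] (K : Type*) [Field K]
    [Algebra F K] (n : ℕ) : ∃ φ : K →ₐ[F] K, ∀ x, φ x = x ^ Nat.card F ^ n := by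
  have := Fintype.ofFinite F
  refine ⟨FiniteField.frobeniusAlgHom F K ^ n, fun x => ?_⟩
  rw [AlgHom.coe_pow, FiniteField.coe_frobeniusAlgHom, pow_iterate, Nat.card_eq_fintype_card]

theorem aeval_pow_card_pow_div (g : F[X]) (E n : ℕ) (x : K) :
    aeval (x ^ Nat.card F ^ n) g / (x ^ Nat.card F ^ n) ^ E =
      (aeval x g / x ^ E) ^ Nat.card F ^ n := by
  obtain ⟨φ, hφ⟩ := exists_algHom_apply_eq_pow_card_pow F K n
  rw [← hφ, ← hφ, aeval_algHom_apply, ← map_pow, ← map_div₀]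

theorem aroots_minpoly_eq_map_range [Algebra.IsAlgebraic F K] [IsAlgClosed K] (x : K) :
    (minpoly F x).aroots K =
      (Finset.range (minpoly F x).natDegree).val.map fun i => x ^ Nat.card F ^ i := by
  have hint : IsIntegral F x := Algebra.IsIntegral.isIntegral x
  have hinj : Set.InjOn (fun i => x ^ Nat.card F ^ i)
      (Finset.range (minpoly F x).natDegree : Set ℕ) := by
    have key : ∀ i j, i ≤ j → j < (minpoly F x).natDegree →
        x ^ Nat.card F ^ i = x ^ Nat.card F ^ j → i = j := by
      intro i j hij hj h
      obtain ⟨φ, hφ⟩ := exists_algHom_apply_eq_pow_card_pow F K i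
      have h1 : φ x = φ (x ^ Nat.card F ^ (j - i)) := by
        rw [hφ, hφ, ← pow_mul, ← pow_add, Nat.sub_add_cancel hij, h]
      have h2 := pow_card_pow_eq_iff.1 (φ.injective h1).symm
      have := Nat.eq_zero_of_dvd_of_lt h2 (by omega)
      omega
    intro i hi j hj h
    simp only [Finset.coe_range, Set.mem_Iio] at hi hj
    rcases le_total i j with hij | hij
    · exact key i j hij hj h
    · exact (key j i hij hi h.symm).symm
  have hnodup : ((Finset.range (minpoly F x).natDegree).val.map
      fun i => x ^ Nat.card F ^ i).Nodup :=
    Multiset.Nodup.map_on (fun i hi j hj h => hinj hi hj h) (Finset.range _).nodup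
  refine (Multiset.eq_of_le_of_card_le ((Multiset.le_iff_subset hnodup).2 ?_) ?_).symm
  · intro y hy
    obtain ⟨i, -, rfl⟩ := Multiset.mem_map.1 hy
    obtain ⟨φ, hφ⟩ := exists_algHom_apply_eq_pow_card_pow F K i
    rw [mem_aroots]
    refine ⟨minpoly.ne_zero hint, ?_⟩
    rw [← hφ, aeval_algHom_apply, minpoly.aeval, map_zero]
  · rw [Multiset.card_map, aroots, IsAlgClosed.card_roots_eq_natDegree, natDegree_map]
    simp

theorem sum_range_mul_of_periodic {M : Type*} [AddCommMonoid M] {f : ℕ → M} {e : ℕ}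
    (hf : Function.Periodic f e) (m : ℕ) :
    ∑ i ∈ Finset.range (m * e), f i = m • ∑ i ∈ Finset.range e, f i := by
  induction m with
  | zero => simp
  | succ m ih =>
    rw [Nat.succ_mul, Finset.sum_range_add, ih, succ_nsmul]
    congr 1
    refine Finset.sum_congr rfl fun i _ => ?_
    rw [add_comm]
    exact hf.nat_mul m i

theorem rootCharacter_minpoly_pow [Algebra.IsAlgebraic F K] [IsAlgClosed K] (χ : AddChar K ℂ)
    (g : F[X]) (E : ℕ) {n : ℕ} {x : K} (hx : x ≠ 0) (hxn : x ^ Nat.card F ^ n = x) :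
    rootCharacter F χ (fun x => aeval x g / x ^ E) (minpoly F x) ^
        (n / (minpoly F x).natDegree) =
      χ (∑ i ∈ Finset.range n, (aeval x g / x ^ E) ^ Nat.card F ^ i) := by
  have hint : IsIntegral F x := Algebra.IsIntegral.isIntegral x
  have h0 : (minpoly F x).coeff 0 ≠ 0 := by rwa [Ne, minpoly.coeff_zero_eq_zero hint]
  have hper : Function.Periodic (fun i => (aeval x g / x ^ E) ^ Nat.card F ^ i)
      (minpoly F x).natDegree := by
    intro i
    simp only
    rw [← aeval_pow_card_pow_div, ← aeval_pow_card_pow_div, add_comm, pow_add, pow_mul,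
      pow_card_pow_eq_iff.2 dvd_rfl]
  obtain ⟨m, hm⟩ := pow_card_pow_eq_iff.1 hxn
  rw [rootCharacter_apply_of_coeff_zero_ne_zero _ _ h0, aroots_minpoly_eq_map_range,
    Multiset.map_map, hm, Nat.mul_div_cancel_left _ (minpoly.natDegree_pos hint),
    mul_comm _ m, sum_range_mul_of_periodic hper, AddChar.map_nsmul_eq_pow]
  congr 3
  exact Multiset.map_congr rfl fun i _ => aeval_pow_card_pow_div g E i x

theorem card_frobeniusFixed [IsAlgClosed K] {n : ℕ} (hn : n ≠ 0) :
    (frobeniusFixed F K n).card = Nat.card F ^ n := by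
  classical
  have := Fintype.ofFinite F
  obtain ⟨p, hp, m, hp', hcard⟩ := FiniteField.card' F
  have : CharP K p := charP_of_injective_algebraMap (algebraMap F K).injective p
  have hdvd : p ∣ Nat.card F ^ n := by
    rw [Nat.card_eq_fintype_card, hcard]
    exact dvd_pow (dvd_pow_self p m.ne_zero) hn
  rw [frobeniusFixed, Multiset.toFinset_card_of_nodup (nodup_roots (galois_poly_separable p _ hdvd)),
    IsAlgClosed.card_roots_eq_natDegree,
    FiniteField.X_pow_card_pow_sub_X_natDegree_eq K hn Finite.one_lt_card]

end

section
variable {p : ℕ} [Fact p.Prime] {F : Type*} [Field F] [Finite F] [Algebra (ZMod p) F]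
  {K : Type*} [Field K] [Algebra F K] [Algebra (ZMod p) K] [IsScalarTower (ZMod p) F K]

theorem exists_linearMap_extends_trace (p : ℕ) [Fact p.Prime] (F : Type*) [Field F] [Finite F]
    [Algebra (ZMod p) F] (K : Type*) [Field K] [Algebra F K] [Algebra (ZMod p) K]
    [IsScalarTower (ZMod p) F K] :
    ∃ τ : K →ₗ[ZMod p] ZMod p,
      ∀ y : F, τ (algebraMap F K y) = Algebra.trace (ZMod p) F y := by
  obtain ⟨r, hr⟩ := (IsScalarTower.toAlgHom (ZMod p) F K).toLinearMap.exists_leftInverse_of_injective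
    (LinearMap.ker_eq_bot.2 (algebraMap F K).injective)
  exact ⟨Algebra.trace (ZMod p) F ∘ₗ r, fun y =>
    congrArg (Algebra.trace (ZMod p) F) (LinearMap.congr_fun hr y)⟩

theorem algebraMap_extends_trace [Algebra.IsAlgebraic F K] {τ : K →ₗ[ZMod p] ZMod p}
    (hτ : ∀ y : F, τ (algebraMap F K y) = Algebra.trace (ZMod p) F y) {n : ℕ} {z : K}
    (hz : z ^ Nat.card F ^ n = z) :
    algebraMap (ZMod p) K (τ (∑ i ∈ Finset.range n, z ^ Nat.card F ^ i)) =
      ∑ r ∈ Finset.range (Module.finrank (ZMod p) F * n), z ^ p ^ r := by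
  have : CharP K p := charP_of_injective_algebraMap (algebraMap (ZMod p) K).injective p
  have hcard : Nat.card F = p ^ Module.finrank (ZMod p) F := by
    have := Module.natCard_eq_pow_finrank (K := ZMod p) (V := F)
    rwa [Nat.card_zmod] at this
  set y := ∑ i ∈ Finset.range n, z ^ Nat.card F ^ i with hy
  have hyq : y ^ Nat.card F ^ 1 = y := by
    obtain ⟨φ, hφ⟩ := exists_algHom_apply_eq_pow_card_pow F K 1
    rw [← hφ, hy, map_sum]
    have : ∀ i, φ (z ^ Nat.card F ^ i) = z ^ Nat.card F ^ (i + 1) := fun i => by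
      rw [hφ, ← pow_mul, ← pow_add]
    simp_rw [this]
    have h1 := Finset.sum_range_succ (fun i => z ^ Nat.card F ^ i) n
    rw [Finset.sum_range_succ', hz, pow_zero, pow_one] at h1
    exact add_right_cancel h1
  obtain ⟨b, hb⟩ : ∃ b : F, algebraMap F K b = y := by
    have h := pow_card_pow_eq_iff.1 hyq
    exact minpoly.natDegree_eq_one_iff.1 (Nat.dvd_one.1 h)
  rw [← hb, hτ, IsScalarTower.algebraMap_apply (ZMod p) F K,
    FiniteField.algebraMap_trace_eq_sum_pow, map_sum, Nat.card_zmod]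
  simp_rw [map_pow, hb, hy, sum_pow_char_pow, ← pow_mul, hcard, ← pow_mul, ← pow_add]
  clear_value y
  clear hz hy hyq hb
  induction n with
  | zero => simp
  | succ n ih =>
    rw [Nat.mul_succ, Finset.sum_range_add, ← ih, ← Finset.sum_add_distrib]
    simp_rw [Finset.sum_range_succ]

theorem norm_lPowerSum_rootCharacter_le [IsAlgClosure F K] {τ : K →ₗ[ZMod p] ZMod p}
    (hτ : ∀ y : F, τ (algebraMap F K y) = Algebra.trace (ZMod p) F y)
    {ψ : AddChar (ZMod p) ℂ} (hψ : ψ ≠ 1) {g : F[X]} {D E : ℕ} (hg : g.natDegree = D + E)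
    (hD : ¬ p ∣ D) {n : ℕ} (hn : n ≠ 0) :
    ‖lPowerSum (rootCharacter F (ψ.compAddMonoidHom τ.toAddMonoidHom)
        fun x => aeval x g / x ^ E) n‖ ≤
      (2 * p * (2 + 2 * (D + E) * p + (D + E) : ℕ) + 1 : ℝ) * √(Nat.card F) ^ n := by
  classical
  have : Algebra.IsAlgebraic F K := IsAlgClosure.isAlgebraic
  have : IsAlgClosed K := IsAlgClosure.isAlgClosed F
  have : CharP K p := charP_of_injective_algebraMap (algebraMap (ZMod p) K).injective p
  have hp1 : 1 < p := (Fact.out : p.Prime).one_lt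
  have hcard : Nat.card F = p ^ Module.finrank (ZMod p) F := by
    have := Module.natCard_eq_pow_finrank (K := ZMod p) (V := F)
    rwa [Nat.card_zmod] at this
  set C₀ := 2 + 2 * (D + E) * p + (D + E) with hC₀
  set s := Module.finrank (ZMod p) F * n with hs
  have hs1 : 1 ≤ s := Nat.mul_pos Module.finrank_pos (Nat.pos_of_ne_zero hn)
  have hqn : Nat.card F ^ n = p ^ s := by rw [hcard, ← pow_mul]
  set A := (frobeniusFixed F K n).erase 0 with hA
  have hAmem : ∀ x ∈ A, x ≠ 0 ∧ x ^ Nat.card F ^ n = x := fun x hx => by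
    rw [hA, Finset.mem_erase, mem_frobeniusFixed hn] at hx
    exact hx
  set c : K → ZMod p := fun x =>
    τ (∑ i ∈ Finset.range n, (aeval x g / x ^ E) ^ Nat.card F ^ i) with hc
  have hcx : ∀ x ∈ A, algebraMap (ZMod p) K (c x) =
      ∑ r ∈ Finset.range s, (aeval x g / x ^ E) ^ p ^ r := fun x hx => by
    refine algebraMap_extends_trace hτ ?_
    rw [← aeval_pow_card_pow_div, (hAmem x hx).2]
  set N : ZMod p → ℕ := fun a => (A.filter fun x => c x = a).card with hN
  have hNle : ∀ a, N a ≤ p ^ (s - 1) + C₀ * p ^ (s / 2) := by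
    intro a
    refine stepanov_bound (K := K) (g := g.map (algebraMap F K)) (by rwa [natDegree_map]) hD hs1
      (algebraMap (ZMod p) K a) _ fun x hx => ?_
    rw [Finset.mem_filter] at hx
    refine ⟨(hAmem x hx.1).1, hqn ▸ (hAmem x hx.1).2, ?_⟩
    rw [eval_map_algebraMap, ← hcx x hx.1, hx.2]
  have hNsum : (∑ a, (N a : ℝ)) = (p : ℝ) ^ s - 1 := by
    have h0 : (0 : K) ∈ frobeniusFixed F K n := by
      rw [mem_frobeniusFixed hn, zero_pow (pow_ne_zero _ Nat.card_pos.ne')]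
    have h1 : ∑ a, N a = A.card :=
      (Finset.card_eq_sum_card_fiberwise (fun _ _ => Finset.mem_coe.2 (Finset.mem_univ _))).symm
    have h2 : A.card + 1 = p ^ s := by
      rw [hA, Finset.card_erase_add_one h0, card_frobeniusFixed hn, hqn]
    have h3 : ((∑ a, N a : ℕ) : ℝ) + 1 = (p : ℝ) ^ s := by
      rw [h1]
      exact_mod_cast h2
    push_cast at h3
    linarith
  have hS : lPowerSum (rootCharacter F (ψ.compAddMonoidHom τ.toAddMonoidHom)
      fun x => aeval x g / x ^ E) n = ∑ a, ((N a : ℂ) - (p : ℂ) ^ (s - 1)) * ψ a := by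
    simp_rw [sub_mul, Finset.sum_sub_distrib, ← Finset.mul_sum, AddChar.sum_eq_zero_of_ne_one hψ,
      mul_zero, sub_zero]
    rw [lPowerSum_eq_sum_frobeniusFixed K _ hn, ← Finset.sum_erase (a := (0 : K)) (frobeniusFixed F K n),
      ← Finset.sum_fiberwise A c]
    · refine Finset.sum_congr rfl fun a _ => ?_
      rw [hN, ← nsmul_eq_mul, ← Finset.sum_const]
      refine Finset.sum_congr rfl fun x hx => ?_
      rw [Finset.mem_filter] at hx
      rw [rootCharacter_minpoly_pow _ _ _ (hAmem x hx.1).1 (hAmem x hx.1).2, ← hx.2]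
      rfl
    · rw [rootCharacter_minpoly_zero, minpoly.zero, natDegree_X, Nat.div_one, zero_pow hn]
  set U : ℝ := C₀ * (p : ℝ) ^ (s / 2) with hU
  have hU0 : 0 ≤ U := by positivity
  have hterm : ∀ a, ‖((N a : ℂ) - (p : ℂ) ^ (s - 1)) * ψ a‖ ≤
      2 * U + (p : ℝ) ^ (s - 1) - N a := by
    intro a
    rw [norm_mul, AddChar.norm_apply, mul_one]
    have h1 : ((N a : ℂ) - (p : ℂ) ^ (s - 1)) = (((N a : ℝ) - (p : ℝ) ^ (s - 1) : ℝ) : ℂ) := by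
      push_cast
      rfl
    have h2 : (N a : ℝ) ≤ (p : ℝ) ^ (s - 1) + U := by
      rw [hU]
      exact_mod_cast hNle a
    rw [h1, Complex.norm_real, Real.norm_eq_abs, abs_le]
    constructor <;> linarith
  have hsqrt : √(Nat.card F : ℝ) ^ n = √((p : ℝ) ^ s) := by
    rw [eq_comm, Real.sqrt_eq_iff_eq_sq (by positivity) (by positivity), ← pow_mul,
      mul_comm n 2, pow_mul √_, Real.sq_sqrt (Nat.cast_nonneg _)]
    exact_mod_cast hqn.symm
  have hhalf : (p : ℝ) ^ (s / 2) ≤ √((p : ℝ) ^ s) := by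
    refine Real.le_sqrt_of_sq_le ?_
    rw [← pow_mul]
    exact pow_le_pow_right₀ (by exact_mod_cast hp1.le) (by omega)
  have hone : 1 ≤ √((p : ℝ) ^ s) := by
    rw [Real.one_le_sqrt]
    exact one_le_pow₀ (by exact_mod_cast hp1.le)
  have hps : (p : ℝ) * (p : ℝ) ^ (s - 1) = (p : ℝ) ^ s := by
    rw [← pow_succ', Nat.sub_add_cancel hs1]
  rw [hS, hsqrt]
  calc _ ≤ ∑ a : ZMod p, (2 * U + (p : ℝ) ^ (s - 1) - N a) :=
        (norm_sum_le _ _).trans (Finset.sum_le_sum fun a _ => hterm a)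
    _ = 2 * p * U + 1 := by
        rw [Finset.sum_sub_distrib, hNsum, Finset.sum_const, Finset.card_univ, ZMod.card,
          nsmul_eq_mul, ← hps]
        ring
    _ ≤ 2 * p * (C₀ * √((p : ℝ) ^ s)) + √((p : ℝ) ^ s) := by
        rw [hU]
        gcongr
    _ = _ := by ring

end

/-- Weil's bound for additive character sums of Laurent polynomials whose pole order at infinity
is prime to the characteristic. -/
theorem norm_sum_addChar_trace_le {p : ℕ} [Fact p.Prime] {F : Type*} [Field F] [Fintype F]
    [DecidableEq F] [Algebra (ZMod p) F] {ψ : AddChar (ZMod p) ℂ} (hψ : ψ ≠ 1)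
    {g : F[X]} {D E : ℕ} (hg : g.natDegree = D + E) (hD : ¬ p ∣ D) :
    ‖∑ x : F with x ≠ 0, ψ (Algebra.trace (ZMod p) F (g.eval x / x ^ E))‖ ≤
      ((D + E : ℕ) : ℝ) * √(Fintype.card F) := by
  classical
  have : CharP F p := charP_of_injective_algebraMap (algebraMap (ZMod p) F).injective p
  let K := AlgebraicClosure F
  obtain ⟨τ, hτ⟩ := exists_linearMap_extends_trace p F K
  set χ := ψ.compAddMonoidHom τ.toAddMonoidHom with hχ
  set l := rootCharacter F χ fun x : K => aeval x g / x ^ E with hl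
  have hχ1 : ∃ b : F, χ (algebraMap F K b) ≠ 1 := by
    obtain ⟨a, ha⟩ := AddChar.ne_one_iff.1 hψ
    obtain ⟨b, rfl⟩ := Algebra.trace_surjective (ZMod p) F a
    refine ⟨b, ?_⟩
    have : χ (algebraMap F K b) = ψ (τ (algebraMap F K b)) := rfl
    rwa [this, hτ]
  have hq : 0 < √(Nat.card F : ℝ) := Real.sqrt_pos.2 (by exact_mod_cast Nat.card_pos)
  have hbound := norm_le_of_newton_recursion (A := lCoeff l) (S := lPowerSum l) hq
    (lCoeff_zero l)
    (fun d hd => lCoeff_rootCharacter_eq_zero hχ1 hg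
      (by rwa [Ne, CharP.cast_eq_zero_iff F p]) hd)
    (succ_mul_lCoeff_succ l)
    (fun n => norm_lPowerSum_rootCharacter_le hτ hψ hg hD n.succ_ne_zero)
  rw [Nat.card_eq_fintype_card] at hbound
  convert hbound using 2
  rw [lPowerSum_eq_sum_frobeniusFixed K l one_ne_zero, Finset.sum_filter]
  refine Finset.sum_bij (fun x _ => algebraMap F K x) ?_ ?_ ?_ ?_
  · intro x _
    rw [mem_frobeniusFixed one_ne_zero, ← map_pow, pow_one, Nat.card_eq_fintype_card,
      FiniteField.pow_card]
  · intro x _ y _ h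
    exact (algebraMap F K).injective h
  · intro y hy
    rw [mem_frobeniusFixed one_ne_zero, pow_card_pow_eq_iff, Nat.dvd_one,
      minpoly.natDegree_eq_one_iff] at hy
    obtain ⟨b, hb⟩ := hy
    exact ⟨b, Finset.mem_univ _, hb⟩
  · intro x _
    by_cases hx : x = 0
    · subst hx
      rw [map_zero, hl, rootCharacter_minpoly_zero, minpoly.zero, natDegree_X]
      simp
    · have hx' : algebraMap F K x ≠ 0 := by simpa using hx
      have hfix : algebraMap F K x ^ Nat.card F ^ 1 = algebraMap F K x := by
        rw [← map_pow, pow_one, Nat.card_eq_fintype_card, FiniteField.pow_card]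
      rw [if_pos hx, hl, rootCharacter_minpoly_pow χ g E hx' hfix, Finset.sum_range_one, pow_zero,
        pow_one, aeval_algebraMap_apply, ← map_pow, ← map_div₀]
      refine congrArg ψ ?_
      rw [← hτ]
      simp

theorem sum_ne_zero_inv {F : Type*} [Field F] [Fintype F] [DecidableEq F] {M : Type*}
    [AddCommMonoid M] (u : F → M) :
    ∑ x : F with x ≠ 0, u x⁻¹ = ∑ x : F with x ≠ 0, u x :=
  Finset.sum_equiv (Equiv.inv F) (by simp) (by simp)

theorem card_ne_zero_ge_of_re_sum_addChar_le {p : ℕ} [Fact p.Prime] {F : Type*} [Field F] [Fintype F]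
    [DecidableEq F] {u : F → ZMod p} {M : ℝ}
    (h : ∀ ψ : AddChar (ZMod p) ℂ, ψ ≠ 1 → (∑ x : F with x ≠ 0, ψ (u x)).re ≤ M) :
    ((p : ℝ) - 1) / p * (Fintype.card F - 1 - M) ≤
      ((Finset.univ.filter fun x : F => x ≠ 0 ∧ u x ≠ 0).card : ℝ) := by
  classical
  have hp0 : (0 : ℝ) < p := by exact_mod_cast (Fact.out : p.Prime).pos
  set A : Finset F := Finset.univ.filter fun x => x ≠ 0
  have hA : (A.card : ℝ) = Fintype.card F - 1 := by
    have : A = Finset.univ.erase 0 := by ext; simp [A]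
    rw [this, Finset.card_erase_of_mem (Finset.mem_univ _), Finset.card_univ,
      Nat.cast_sub Fintype.card_pos, Nat.cast_one]
  set N := (A.filter fun x => u x = 0).card
  have hsplit : ((Finset.univ.filter fun x : F => x ≠ 0 ∧ u x ≠ 0).card : ℝ) = A.card - N := by
    rw [← Finset.card_filter_add_card_filter_not (s := A) (fun x => u x = 0), Finset.filter_filter,
      Finset.filter_filter]
    push_cast
    simp [N, A, Finset.filter_filter]
  have hsum : ∑ ψ : AddChar (ZMod p) ℂ, ∑ x ∈ A, ψ (u x) = p * N := by
    rw [Finset.sum_comm]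
    simp_rw [AddChar.sum_apply_eq_ite]
    rw [← Finset.sum_filter, Finset.sum_const, ZMod.card, nsmul_eq_mul, mul_comm]
  have hre : (p : ℝ) * N = ∑ ψ : AddChar (ZMod p) ℂ, (∑ x ∈ A, ψ (u x)).re := by
    rw [← Complex.re_sum, hsum]
    simp
  have hle : (p : ℝ) * N ≤ A.card + (p - 1) * M := by
    rw [hre, ← Finset.add_sum_erase _ _ (Finset.mem_univ (1 : AddChar (ZMod p) ℂ))]
    refine add_le_add (by simp) ?_
    refine (Finset.sum_le_card_nsmul _ _ M fun ψ hψ => h ψ (Finset.ne_of_mem_erase hψ)).trans ?_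
    rw [Finset.card_erase_of_mem (Finset.mem_univ _), Finset.card_univ, AddChar.card_eq, ZMod.card,
      nsmul_eq_mul, Nat.cast_sub (Fact.out : p.Prime).one_le, Nat.cast_one]
  rw [hsplit, ← hA, div_mul_eq_mul_div, div_le_iff₀ hp0]
  linarith

section
variable {p : ℕ} [Fact p.Prime] {F : Type*} [Field F] [Fintype F] [Algebra (ZMod p) F]

theorem trace_zmod_pow_char (x : F) :
    Algebra.trace (ZMod p) F (x ^ p) = Algebra.trace (ZMod p) F x := by
  rw [← Algebra.trace_eq_of_algEquiv (FiniteField.frobeniusAlgEquivOfAlgebraic (ZMod p) F) x,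
    FiniteField.coe_frobeniusAlgEquivOfAlgebraic, ZMod.card]

theorem exists_trace_eval_eq_and_not_dvd_natDegree (g : F[X]) :
    ∃ g' : F[X], g'.natDegree ≤ g.natDegree ∧ (g'.natDegree = 0 ∨ ¬ p ∣ g'.natDegree) ∧
      ∀ x, Algebra.trace (ZMod p) F (g'.eval x) = Algebra.trace (ZMod p) F (g.eval x) := by
  induction hN : g.natDegree using Nat.strong_induction_on generalizing g with
  | _ N ih =>
    subst hN
    by_cases h : g.natDegree = 0 ∨ ¬ p ∣ g.natDegree
    · exact ⟨g, le_rfl, h, fun _ => rfl⟩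
    push Not at h
    obtain ⟨h0, m, hm⟩ := h
    have hp1 : 1 < p := (Fact.out : p.Prime).one_lt
    have : CharP F p := charP_of_injective_algebraMap (algebraMap (ZMod p) F).injective p
    obtain ⟨b, hb⟩ := surjective_frobenius F p g.leadingCoeff
    rw [frobenius_def] at hb
    have hm0 : 0 < m := Nat.pos_of_ne_zero (by rintro rfl; simp [hm] at h0)
    have hmN : m < g.natDegree := by rw [hm]; nlinarith
    set g₁ := g.eraseLead + C b * X ^ m with hg₁
    have hlt : g₁.natDegree < g.natDegree := by
      refine (natDegree_add_le _ _).trans_lt (max_lt ?_ ?_)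
      · have := eraseLead_natDegree_le g
        omega
      · exact (natDegree_C_mul_X_pow_le _ _).trans_lt hmN
    obtain ⟨g', h1, h2, h3⟩ := ih _ hlt g₁ rfl
    refine ⟨g', h1.trans hlt.le, h2, fun x => ?_⟩
    rw [h3, hg₁, eval_add, map_add, eval_C_mul, eval_pow, eval_X, ← trace_zmod_pow_char (b * x ^ m)]
    conv_rhs => rw [← eraseLead_add_C_mul_X_pow g]
    rw [eval_add, map_add, eval_C_mul, eval_pow, eval_X, mul_pow, hb, ← pow_mul, mul_comm m p, hm]

theorem re_sum_addChar_trace_div_le_of_coeff_zero_ne_zero [DecidableEq F]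
    {ψ : AddChar (ZMod p) ℂ} (hψ : ψ ≠ 1) {f : F[X]} {m : ℕ} (hf : f.natDegree ≤ m)
    (hf0 : f.coeff 0 ≠ 0) :
    (∑ x : F with x ≠ 0, ψ (Algebra.trace (ZMod p) F (f.eval x / x))).re ≤
      m * √(Fintype.card F) := by
  rw [← sum_ne_zero_inv]
  rcases m with _ | m
  · rw [eq_C_of_natDegree_le_zero hf]
    set a := f.coeff 0
    have hχ : ψ.compAddMonoidHom ((Algebra.trace (ZMod p) F).toAddMonoidHom.comp
        (AddMonoidHom.mulLeft a)) ≠ 1 := by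
      obtain ⟨c, hc⟩ := AddChar.ne_one_iff.1 hψ
      obtain ⟨b, rfl⟩ := Algebra.trace_surjective (ZMod p) F c
      refine AddChar.ne_one_iff.2 ⟨a⁻¹ * b, ?_⟩
      simpa [mul_inv_cancel_left₀ hf0] using hc
    have hsum := AddChar.sum_eq_zero_of_ne_one hχ
    rw [← Finset.sum_filter_add_sum_filter_not _ (fun x => x ≠ 0)] at hsum
    simp only [ne_eq, not_not, Finset.filter_eq', Finset.mem_univ, if_true,
      Finset.sum_singleton, AddChar.map_zero_eq_one] at hsum
    have : ∑ x : F with x ≠ 0, ψ (Algebra.trace (ZMod p) F ((C a).eval x⁻¹ / x⁻¹)) = -1 := by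
      rw [← eq_neg_iff_add_eq_zero] at hsum
      rw [← hsum]
      refine Finset.sum_congr rfl fun x _ => ?_
      simp
    rw [this]
    simp
  · have hdeg : (reflect (m + 1) f).natDegree = 1 + m := by
      refine le_antisymm ((natDegree_le_iff_coeff_eq_zero).2 fun i hi => ?_)
        (le_natDegree_of_ne_zero ?_)
      · rw [coeff_reflect, revAt_eq_self_of_lt (by omega)]
        exact coeff_eq_zero_of_natDegree_lt (by omega)
      · rwa [coeff_reflect, revAt_le (by omega), show m + 1 - (1 + m) = 0 by omega]
    have hp1 : 1 < p := (Fact.out : p.Prime).one_lt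
    have h := norm_sum_addChar_trace_le hψ hdeg (Nat.not_dvd_of_pos_of_lt one_pos hp1)
    refine (Complex.re_le_norm _).trans ?_
    rw [add_comm 1 m] at h
    refine (le_of_eq (congrArg norm (Finset.sum_congr rfl fun x hx => ?_))).trans h
    have hx : x ≠ 0 := (Finset.mem_filter.1 hx).2
    let := invertibleOfNonzero (inv_ne_zero hx)
    have hr := eval₂_reflect_mul_pow (RingHom.id F) x⁻¹ (m + 1) f hf
    rw [invOf_eq_inv, inv_inv] at hr
    change eval x _ * _ = eval x⁻¹ f at hr
    rw [← hr, inv_pow, pow_succ]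
    congr 2
    field_simp

end

/-- Character sum bound, `m = 1`: with `B = F_p` the prime field and
`Tr : F → F_p` the absolute trace, `|F| = p^t`, every not-identically-zero repair-trace
word `(Tr(f(α)/α))_{α ≠ 0}` has Hamming weight `w` satisfying (over the reals)
`w ≥ ((p−1)/p)·(p^t − 1 − (k−1)·√(p^t))`. -/
theorem stmt_4 (p t k : ℕ) (hp : p.Prime) (ht : 1 ≤ t) (hk : 1 ≤ k)
    (F : Type) [Field F] [Fintype F] [Algebra (ZMod p) F]
    (hcardF : Fintype.card F = p ^ t)
    (Tr : F → ZMod p)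
    (hTr : ∀ x : F, algebraMap (ZMod p) F (Tr x) = ∑ i ∈ Finset.range t, x ^ p ^ i)
    (f : Polynomial F)
    (hf : f.degree ≤ ((k - 1 : ℕ) : WithBot ℕ))
    (hnz : ∃ α : F, α ≠ 0 ∧ Tr (f.eval α / α) ≠ 0) :
    ((p : ℝ) - 1) / (p : ℝ) *
        ((p : ℝ) ^ t - 1 - ((k : ℝ) - 1) * Real.sqrt ((p : ℝ) ^ t))
      ≤ ({α : F | α ≠ 0 ∧ Tr (f.eval α / α) ≠ 0}.ncard : ℝ) := by
  classical
  have : Fact p.Prime := ⟨hp⟩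
  have hfin : Module.finrank (ZMod p) F = t := by
    have h := Module.card_eq_pow_finrank (K := ZMod p) (V := F)
    rw [ZMod.card, hcardF] at h
    exact (Nat.pow_right_injective hp.two_le h).symm
  have hTrace : ∀ x, Tr x = Algebra.trace (ZMod p) F x := fun x => by
    apply (algebraMap (ZMod p) F).injective
    rw [hTr, FiniteField.algebraMap_trace_eq_sum_pow, hfin, Nat.card_zmod]
  have hq : (p : ℝ) ^ t = Fintype.card F := by rw [hcardF, Nat.cast_pow]
  have hk1 : (k : ℝ) - 1 = (k - 1 : ℕ) := by rw [Nat.cast_sub hk, Nat.cast_one]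
  have hdeg : f.natDegree ≤ k - 1 := natDegree_le_of_degree_le hf
  have hset : {α : F | α ≠ 0 ∧ Tr (f.eval α / α) ≠ 0}.ncard =
      (Finset.univ.filter fun x : F =>
        x ≠ 0 ∧ Algebra.trace (ZMod p) F (f.eval x / x) ≠ 0).card := by
    rw [← Set.ncard_coe_finset]
    simp [hTrace]
  rw [hset, hq, hk1]
  by_cases hf0 : f.coeff 0 = 0
  · obtain ⟨g, hg1, hg2, hg3⟩ := exists_trace_eval_eq_and_not_dvd_natDegree (p := p) f.divX
    have hval : ∀ x : F, x ≠ 0 → Algebra.trace (ZMod p) F (f.eval x / x) =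
        Algebra.trace (ZMod p) F (g.eval x) := fun x hx => by
      rw [hg3]
      congr 1
      conv_lhs => rw [← divX_mul_X_add f, hf0]
      simp [hx]
    rcases hg2 with hg0 | hgp
    · obtain ⟨α, hα, hne⟩ := hnz
      rw [hTrace, hval α hα, eq_C_of_natDegree_eq_zero hg0, eval_C] at hne
      have hall : (Finset.univ.filter fun x : F =>
          x ≠ 0 ∧ Algebra.trace (ZMod p) F (f.eval x / x) ≠ 0) = Finset.univ.erase 0 := by
        ext x
        simp only [Finset.mem_filter, Finset.mem_univ, true_and, Finset.mem_erase, and_true,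
          and_iff_left_iff_imp]
        intro hx
        rwa [hval x hx, eq_C_of_natDegree_eq_zero hg0, eval_C]
      rw [hall, Finset.card_erase_of_mem (Finset.mem_univ _), Finset.card_univ,
        Nat.cast_sub Fintype.card_pos, Nat.cast_one]
      have hp0 : (0 : ℝ) < p := by exact_mod_cast hp.pos
      have hp1 : (1 : ℝ) ≤ p := by exact_mod_cast hp.one_le
      have hq1 : (1 : ℝ) ≤ Fintype.card F := by exact_mod_cast Fintype.card_pos
      have hM : (0 : ℝ) ≤ (k - 1 : ℕ) * √(Fintype.card F : ℝ) := by positivity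
      rw [div_mul_eq_mul_div, div_le_iff₀ hp0]
      nlinarith [mul_nonneg (sub_nonneg.2 hp1) hM]
    · refine card_ne_zero_ge_of_re_sum_addChar_le fun ψ hψ => (Complex.re_le_norm _).trans ?_
      have h := norm_sum_addChar_trace_le hψ (add_zero g.natDegree).symm hgp
      rw [Finset.sum_congr rfl (g := fun x => ψ (Algebra.trace (ZMod p) F (g.eval x / x ^ 0)))
        fun x hx => by rw [hval x (Finset.mem_filter.1 hx).2, pow_zero, div_one]]
      refine h.trans ?_
      gcongr
      rw [natDegree_divX_eq_natDegree_tsub_one] at hg1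
      omega
  · exact card_ne_zero_ge_of_re_sum_addChar_le fun ψ hψ =>
      re_sum_addChar_trace_div_le_of_coeff_zero_ne_zero hψ hdeg hf0
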